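/- Let N ≥ 1, let b be a real number with −N < b < 1, let p > 1 + (2−b)/N, set r_* := N(p−1)/(2−b) > 1, and let 1 ≤ r ≤ r_*. Let Γ : ℝ^N × ℝ^N × (0,∞) → ℝ be a measurable nonnegative kernel satisfying (K1), (K2), and the upper Gaussian-type bound: there exist C₀, c₀ > 0 such that Γ(x,y,t) ≤ C₀ t^{−N/(2−b)} exp(−c₀ (|x−y|^{(2−b)}/t)^{1/(1−b)}) for all x, y ∈ ℝ^N and t > 0. Then there exists δ > 0 such that for every nonnegative φ ∈ L^∞(ℝ^N) ∩ L^r(ℝ^N) with ‖φ‖_r^{r/r_*} · ‖φ‖_∞^{1 − r/r_*} < δ, there exists a global-in-time mild solution u of u_t = div(w∇u) + u^p with kernel Γ and initial data φ, and it satisfies sup_{t>0} (1+t)^{(N/(2−b))(1/r − 1/q)} ‖u(·,t)‖_q < ∞ for every q with r ≤ q ≤ ∞. -/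

import Mathlib

open MeasureTheory Real Set
open scoped ENNReal

noncomputable section

/-- `N`-dimensional Euclidean space. -/
abbrev E (N : ℕ) : Type := EuclideanSpace ℝ (Fin N)

/-- A mild solution of `u_t = div(w ∇u) + u^p` with kernel `Γ` and initial data `φ`
on `ℝ^N × (0,T)` (`T ∈ (0,∞]`): a nonnegative measurable function, essentially bounded
on `ℝ^N × (0,T)`, satisfying the Duhamel integral identity (with all integrals finite). -/
def IsMildSolution (N : ℕ) (p : ℝ) (Γ : E N → E N → ℝ → ℝ)
    (φ : E N → ℝ) (T : ℝ≥0∞) (u : E N → ℝ → ℝ) : Prop :=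
  Measurable (fun q : E N × ℝ => u q.1 q.2) ∧
  (∀ x t, 0 ≤ u x t) ∧
  (∃ M : ℝ, ∀ t : ℝ, 0 < t → ENNReal.ofReal t < T →
    ∀ᵐ x : E N ∂volume, u x t ≤ M) ∧
  (∀ t : ℝ, 0 < t → ENNReal.ofReal t < T →
    ∀ᵐ x : E N ∂volume,
      Integrable (fun y => Γ x y t * φ y) volume ∧
      Integrable (fun q : E N × ℝ => Γ x q.1 (t - q.2) * u q.1 q.2 ^ p)
        (volume.prod (volume.restrict (Ioo (0:ℝ) t))) ∧
      u x t = (∫ y, Γ x y t * φ y) +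
        ∫ s in Ioo (0:ℝ) t, ∫ y, Γ x y (t - s) * u y s ^ p)

/-- The weak `L^r` quasinorm `‖f‖_{r,∞} = sup_{λ>0} λ |{|f|>λ}|^{1/r}`. -/
def weakNorm (N : ℕ) (r : ℝ) (f : E N → ℝ) : ℝ≥0∞ :=
  ⨆ (l : ℝ) (_ : 0 < l), ENNReal.ofReal l * (volume {x : E N | l < |f x|}) ^ (1 / r)

/-- `K` is the (extended nonnegative) transition density of a semigroup of doubly stochastic
operators: unit mass in both space variables and the Chapman–Kolmogorov identity. -/
structure IsTransitionDensity {X : Type*} [MeasureSpace X] (K : X → X → ℝ → ℝ≥0∞) : Prop where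
  measurable : Measurable fun q : X × X × ℝ => K q.1 q.2.1 q.2.2
  lintegral_left : ∀ y t, 0 < t → ∫⁻ x, K x y t = 1
  lintegral_right : ∀ x t, 0 < t → ∫⁻ y, K x y t = 1
  semigroup : ∀ x y s t, 0 < s → s < t → K x y t = ∫⁻ ξ, K x ξ (t - s) * K ξ y s

/-- The action on a function `f` of the operator with kernel `K` at time `t`. -/
def evolve {X : Type*} [MeasureSpace X] (K : X → X → ℝ → ℝ≥0∞) (f : X → ℝ≥0∞)
    (t : ℝ) (x : X) : ℝ≥0∞ :=
  ∫⁻ y, K x y t * f y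

/-- The Duhamel operator `v ↦ S(t)φ + ∫₀ᵗ S(t-s) v(s)^p ds`. -/
def duhamel {X : Type*} [MeasureSpace X] (K : X → X → ℝ → ℝ≥0∞) (p : ℝ) (φ : X → ℝ≥0∞)
    (v : X → ℝ → ℝ≥0∞) (x : X) (t : ℝ) : ℝ≥0∞ :=
  evolve K φ t x + ∫⁻ s in Ioo 0 t, evolve K (fun y => v y s ^ p) (t - s) x

/-- The monotone iteration of the Duhamel operator started at zero. -/
def picard {X : Type*} [MeasureSpace X] (K : X → X → ℝ → ℝ≥0∞) (p : ℝ) (φ : X → ℝ≥0∞) :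
    ℕ → X → ℝ → ℝ≥0∞
  | 0 => fun _ _ => 0
  | n + 1 => duhamel K p φ (picard K p φ n)

section Evolution

variable {X : Type*} [MeasureSpace X] {K : X → X → ℝ → ℝ≥0∞}

lemma evolve_mono {f g : X → ℝ≥0∞} (h : ∀ y, f y ≤ g y) (t : ℝ) (x : X) :
    evolve K f t x ≤ evolve K g t x :=
  lintegral_mono fun y => by gcongr; exact h y

lemma evolve_le_mul_lintegral {f : X → ℝ≥0∞} (hf : Measurable f) {c : ℝ≥0∞} {t : ℝ} {x : X}
    (hc : ∀ y, K x y t ≤ c) : evolve K f t x ≤ c * ∫⁻ y, f y := by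
  rw [← lintegral_const_mul _ hf]
  exact lintegral_mono fun y => by gcongr; exact hc y

lemma duhamel_mono {p : ℝ} (hp : 0 ≤ p) (φ : X → ℝ≥0∞) {v w : X → ℝ → ℝ≥0∞}
    (h : ∀ x t, 0 < t → v x t ≤ w x t) (x : X) (t : ℝ) :
    duhamel K p φ v x t ≤ duhamel K p φ w x t := by
  unfold duhamel
  refine add_le_add le_rfl ?_
  refine setLIntegral_mono' measurableSet_Ioo fun s hs => evolve_mono (fun y => ?_) _ _
  exact ENNReal.rpow_le_rpow (h y s hs.1) hp

lemma picard_monotone {p : ℝ} (hp : 0 ≤ p) (φ : X → ℝ≥0∞) : Monotone (picard K p φ) := by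
  refine monotone_nat_of_le_succ fun n => ?_
  induction n with
  | zero => intro x t; exact (zero_le : (0 : ℝ≥0∞) ≤ _)
  | succ n ih => intro x t; exact duhamel_mono hp φ (fun x t _ => ih x t) x t

namespace IsTransitionDensity

lemma measurable_right (hK : IsTransitionDensity K) (x : X) (t : ℝ) :
    Measurable fun y => K x y t :=
  hK.measurable.comp (g := fun q : X × X × ℝ => K q.1 q.2.1 q.2.2)
    (f := fun y : X => (x, y, t)) (by fun_prop)

lemma evolve_le_of_ae_le (hK : IsTransitionDensity K)
    {f : X → ℝ≥0∞} {c : ℝ≥0∞} (hf : ∀ᵐ y, f y ≤ c) {t : ℝ} (ht : 0 < t)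
    (x : X) : evolve K f t x ≤ c := by
  calc evolve K f t x ≤ ∫⁻ y, K x y t * c := by
        refine lintegral_mono_ae ?_
        filter_upwards [hf] with y hy
        gcongr
    _ = c := by
        rw [lintegral_mul_const _ (hK.measurable_right x t), hK.lintegral_right x t ht, one_mul]

/-- Jensen's inequality between power means with respect to `K(x, ·, t)`. -/
lemma evolve_rpow_le (hK : IsTransitionDensity K)
    {f : X → ℝ≥0∞} (hf : Measurable f) {k r : ℝ} (hk : 0 < k) (hkr : k ≤ r)
    {t : ℝ} (ht : 0 < t) (x : X) :
    evolve K (fun y => f y ^ k) t x ^ (1 / k) ≤ evolve K (fun y => f y ^ r) t x ^ (1 / r) := by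
  set μ : Measure X := volume.withDensity fun y => K x y t
  have : IsProbabilityMeasure μ := ⟨by
    rw [withDensity_apply _ MeasurableSet.univ, Measure.restrict_univ, hK.lintegral_right x t ht]⟩
  have key := eLpNorm'_le_eLpNorm'_of_exponent_le hk hkr μ hf.aestronglyMeasurable
  have hE : ∀ m : ℝ, evolve K (fun y => f y ^ m) t x = ∫⁻ y, f y ^ m ∂μ := fun m => by
    rw [lintegral_withDensity_eq_lintegral_mul _ (hK.measurable_right x t) (hf.pow_const m)]
    rfl
  simpa only [eLpNorm', enorm_eq_self, ← hE] using key

lemma evolve_iSup (hK : IsTransitionDensity K)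
    {f : ℕ → X → ℝ≥0∞} (hf : ∀ n, Measurable (f n)) (hmono : Monotone f)
    (t : ℝ) (x : X) : evolve K (fun y => ⨆ n, f n y) t x = ⨆ n, evolve K (f n) t x := by
  unfold evolve
  simp_rw [ENNReal.mul_iSup]
  exact lintegral_iSup (fun n => (hK.measurable_right x t).mul (hf n))
    fun m n h y => by dsimp only; gcongr; exact hmono h y

variable [SFinite (volume : Measure X)]

lemma measurable_evolve (hK : IsTransitionDensity K)
    {Y : Type*} [MeasurableSpace Y] {f : Y → X → ℝ≥0∞}
    (hf : Measurable (Function.uncurry f)) {τ : Y → ℝ} (hτ : Measurable τ) {ξ : Y → X}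
    (hξ : Measurable ξ) : Measurable fun a => evolve K (f a) (τ a) (ξ a) := by
  unfold evolve
  refine Measurable.lintegral_prod_right' (f := fun q : Y × X => K (ξ q.1) q.2 (τ q.1) * f q.1 q.2)
    ?_
  refine Measurable.mul ?_ hf
  exact hK.measurable.comp (g := fun q : X × X × ℝ => K q.1 q.2.1 q.2.2)
    (f := fun q : Y × X => (ξ q.1, q.2, τ q.1)) (by fun_prop)

lemma measurable_duhamel (hK : IsTransitionDensity K)
    {p : ℝ} {φ : X → ℝ≥0∞} (hφ : Measurable φ) {v : X → ℝ → ℝ≥0∞}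
    (hv : Measurable (Function.uncurry v)) :
    Measurable (Function.uncurry (duhamel K p φ v)) := by
  have h1 : Measurable fun q : X × ℝ => evolve K φ q.2 q.1 :=
    hK.measurable_evolve (f := fun _ : X × ℝ => φ) (hφ.comp measurable_snd) measurable_snd
      measurable_fst
  have h2 : Measurable fun q : (X × ℝ) × ℝ =>
      evolve K (fun y => v y q.2 ^ p) (q.1.2 - q.2) q.1.1 := by
    refine hK.measurable_evolve (f := fun (q : (X × ℝ) × ℝ) y => v y q.2 ^ p) ?_ (by fun_prop)
      (by fun_prop)
    exact (hv.comp (f := fun a : ((X × ℝ) × ℝ) × X => (a.2, a.1.2)) (by fun_prop)).pow_const p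
  have hS : MeasurableSet {q : (X × ℝ) × ℝ | q.2 ∈ Ioo 0 q.1.2} :=
    (measurableSet_lt measurable_const measurable_snd).inter
      (measurableSet_lt measurable_snd (by fun_prop))
  have h3 : Measurable fun q : X × ℝ =>
      ∫⁻ s in Ioo 0 q.2, evolve K (fun y => v y s ^ p) (q.2 - s) q.1 := by
    simp_rw [← lintegral_indicator measurableSet_Ioo]
    exact (h2.indicator hS).lintegral_prod_right'
  exact h1.add h3

lemma measurable_picard (hK : IsTransitionDensity K)
    {p : ℝ} {φ : X → ℝ≥0∞} (hφ : Measurable φ) (n : ℕ) :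
    Measurable (Function.uncurry (picard K p φ n)) := by
  induction n with
  | zero => exact measurable_const
  | succ n ih => exact hK.measurable_duhamel hφ ih

/-- The limit of the monotone iteration is a fixed point of the Duhamel operator. -/
lemma iSup_picard_eq (hK : IsTransitionDensity K)
    {p : ℝ} (hp : 0 < p) {φ : X → ℝ≥0∞} (hφ : Measurable φ) (x : X) (t : ℝ) :
    ⨆ n, picard K p φ n x t = duhamel K p φ (fun x t => ⨆ n, picard K p φ n x t) x t := by
  have hmono := picard_monotone (K := K) hp.le φ
  have hpow : ∀ y s, (⨆ n, picard K p φ n y s) ^ p = ⨆ n, picard K p φ n y s ^ p := fun y s =>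
    (ENNReal.orderIsoRpow p hp).map_iSup _
  have hmeas : ∀ n s, Measurable fun y => picard K p φ n y s ^ p := fun n s =>
    ((hK.measurable_picard hφ n).comp (f := fun y : X => (y, s)) (by fun_prop)).pow_const p
  have hmono' : ∀ s, Monotone fun n y => picard K p φ n y s ^ p := fun s m n h y =>
    ENNReal.rpow_le_rpow (hmono h y s) hp.le
  have hD : duhamel K p φ (fun x t => ⨆ n, picard K p φ n x t) x t
      = ⨆ n, picard K p φ (n + 1) x t := by
    simp only [duhamel, picard, hpow]
    rw [← ENNReal.add_iSup]
    congr 1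
    simp_rw [fun s => hK.evolve_iSup (fun n => hmeas n s) (hmono' s) (t - s) x]
    refine lintegral_iSup (fun n => ?_) fun m n h s => evolve_mono (hmono' s h) _ _
    refine hK.measurable_evolve (f := fun s y => picard K p φ n y s ^ p) ?_ (by fun_prop)
      measurable_const
    exact ((hK.measurable_picard hφ n).comp (f := fun a : ℝ × X => (a.2, a.1))
      (by fun_prop)).pow_const p
  rw [hD]
  exact (Monotone.iSup_nat_add (f := fun n => picard K p φ n x t)
    (fun m n h => hmono h x t) 1).symm

lemma evolve_evolve (hK : IsTransitionDensity K)
    {f : X → ℝ≥0∞} (hf : Measurable f) {s t : ℝ} (hs : 0 < s) (hst : s < t)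
    (x : X) : evolve K (evolve K f s) (t - s) x = evolve K f t x := by
  have hm1 : Measurable fun q : X × X => K x q.1 (t - s) :=
    (hK.measurable_right x (t - s)).comp measurable_fst
  have hm2 : Measurable fun q : X × X => K q.1 q.2 s :=
    hK.measurable.comp (g := fun q : X × X × ℝ => K q.1 q.2.1 q.2.2)
      (f := fun q : X × X => (q.1, q.2, s)) (by fun_prop)
  have hm2' : ∀ ξ, Measurable fun y => K ξ y s := fun ξ => hK.measurable_right ξ s
  have hm3 : ∀ y, Measurable fun ξ => K ξ y s := fun y =>
    hm2.comp (f := fun ξ : X => (ξ, y)) (by fun_prop)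
  unfold evolve
  calc ∫⁻ ξ, K x ξ (t - s) * ∫⁻ y, K ξ y s * f y
      = ∫⁻ ξ, ∫⁻ y, K x ξ (t - s) * (K ξ y s * f y) := by
        refine lintegral_congr fun ξ => ?_
        rw [lintegral_const_mul _ (f := fun y => K ξ y s * f y) ((hm2' ξ).mul hf)]
    _ = ∫⁻ y, ∫⁻ ξ, K x ξ (t - s) * (K ξ y s * f y) :=
        lintegral_lintegral_swap
          (hm1.mul (hm2.mul (hf.comp measurable_snd))).aemeasurable
    _ = ∫⁻ y, K x y t * f y := by
        refine lintegral_congr fun y => ?_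
        simp_rw [← mul_assoc]
        rw [lintegral_mul_const _ (f := fun ξ => K x ξ (t - s) * K ξ y s)
          ((hK.measurable_right x (t - s)).mul (hm3 y)),
          ← hK.semigroup x y s t hs hst]

lemma lintegral_evolve (hK : IsTransitionDensity K)
    {f : X → ℝ≥0∞} (hf : Measurable f) {t : ℝ} (ht : 0 < t) :
    ∫⁻ x, evolve K f t x = ∫⁻ y, f y := by
  have hm2 : Measurable fun q : X × X => K q.1 q.2 t :=
    hK.measurable.comp (g := fun q : X × X × ℝ => K q.1 q.2.1 q.2.2)
      (f := fun q : X × X => (q.1, q.2, t)) (by fun_prop)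
  unfold evolve
  rw [lintegral_lintegral_swap (hm2.mul (hf.comp measurable_snd)).aemeasurable]
  refine lintegral_congr fun y => ?_
  rw [lintegral_mul_const _ (f := fun ξ => K ξ y t)
    (hm2.comp (f := fun ξ : X => (ξ, y)) (by fun_prop)),
    hK.lintegral_left y t ht, one_mul]

/-- The function `2 (S(t) φ^k)^{1/k}` is a supersolution of the Duhamel equation as soon as
the sup bound `G` of `S(t) φ^k` satisfies a smallness condition. -/
lemma duhamel_supersolution_le (hK : IsTransitionDensity K)
    {p k : ℝ} (hk : 1 ≤ k) (hkp : k ≤ p) {φ : X → ℝ≥0∞}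
    (hφ : Measurable φ) {G : ℝ → ℝ≥0∞} (hG : Measurable G)
    (hfG : ∀ x t, 0 < t → evolve K (fun y => φ y ^ k) t x ≤ G t)
    (hsmall : ∀ t, 0 < t →
      2 ^ p * (∫⁻ s in Ioo 0 t, G s ^ ((p - k) / k)) * G t ^ ((k - 1) / k) ≤ 1)
    (x : X) {t : ℝ} (ht : 0 < t) :
    duhamel K p φ (fun x t => 2 * evolve K (fun y => φ y ^ k) t x ^ (1 / k)) x t
      ≤ 2 * evolve K (fun y => φ y ^ k) t x ^ (1 / k) := by
  have hk0 : 0 < k := by linarith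
  have hf : Measurable fun y => φ y ^ k := hφ.pow_const k
  set f : X → ℝ≥0∞ := fun y => φ y ^ k
  have h1 : evolve K φ t x ≤ evolve K f t x ^ (1 / k) := by
    simpa using hK.evolve_rpow_le hφ one_pos hk ht x
  have hmf : ∀ s, Measurable (evolve K f s) := fun s =>
    hK.measurable_evolve (f := fun _ : X => f) (hf.comp measurable_snd) measurable_const
      measurable_id
  have h2 : ∀ s ∈ Ioo 0 t, evolve K (fun y => (2 * evolve K f s y ^ (1 / k)) ^ p) (t - s) x
      ≤ 2 ^ p * G s ^ ((p - k) / k) * evolve K f t x := fun s hs => by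
    rw [← hK.evolve_evolve hf hs.1 hs.2 x]
    change ∫⁻ y, _ ≤ _ * ∫⁻ y, K x y (t - s) * evolve K f s y
    rw [← lintegral_const_mul _ (f := fun y => K x y (t - s) * evolve K f s y)
      ((hK.measurable_right x (t - s)).mul (hmf s))]
    refine lintegral_mono fun y => ?_
    change K x y (t - s) * (2 * evolve K f s y ^ (1 / k)) ^ p
      ≤ 2 ^ p * G s ^ ((p - k) / k) * (K x y (t - s) * evolve K f s y)
    have h3 : (2 * evolve K f s y ^ (1 / k)) ^ p
        ≤ 2 ^ p * (G s ^ ((p - k) / k) * evolve K f s y) := by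
      rw [ENNReal.mul_rpow_of_nonneg _ _ (by linarith), ← ENNReal.rpow_mul,
        show 1 / k * p = (p - k) / k + 1 by field_simp; ring,
        ENNReal.rpow_add_of_nonneg _ _ (div_nonneg (by linarith) hk0.le) zero_le_one,
        ENNReal.rpow_one]
      gcongr _ * (?_ * _)
      exact ENNReal.rpow_le_rpow (hfG y s hs.1) (div_nonneg (by linarith) hk0.le)
    calc _ ≤ K x y (t - s) * (2 ^ p * (G s ^ ((p - k) / k) * evolve K f s y)) := by gcongr
      _ = _ := by ring
  have h4 : evolve K f t x = evolve K f t x ^ ((k - 1) / k) * evolve K f t x ^ (1 / k) := by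
    rw [← ENNReal.rpow_add_of_nonneg _ _ (div_nonneg (by linarith) hk0.le) (by positivity),
      ← add_div, sub_add_cancel, div_self hk0.ne', ENNReal.rpow_one]
  unfold duhamel
  rw [two_mul]
  refine add_le_add h1 ?_
  calc ∫⁻ s in Ioo 0 t, evolve K (fun y => (2 * evolve K f s y ^ (1 / k)) ^ p) (t - s) x
      ≤ ∫⁻ s in Ioo 0 t, 2 ^ p * G s ^ ((p - k) / k) * evolve K f t x :=
        setLIntegral_mono' measurableSet_Ioo h2
    _ = 2 ^ p * (∫⁻ s in Ioo 0 t, G s ^ ((p - k) / k)) * evolve K f t x := by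
        rw [lintegral_mul_const _ ((hG.pow_const _).const_mul _),
          lintegral_const_mul _ (hG.pow_const _)]
    _ = 2 ^ p * (∫⁻ s in Ioo 0 t, G s ^ ((p - k) / k)) * evolve K f t x ^ ((k - 1) / k)
          * evolve K f t x ^ (1 / k) := by
        rw [mul_assoc _ (evolve K f t x ^ ((k - 1) / k)), ← h4]
    _ ≤ 2 ^ p * (∫⁻ s in Ioo 0 t, G s ^ ((p - k) / k)) * G t ^ ((k - 1) / k)
          * evolve K f t x ^ (1 / k) := by
        gcongr ?_ * ?_ * _
        · exact le_rfl
        · exact ENNReal.rpow_le_rpow (hfG x t ht) (div_nonneg (by linarith) hk0.le)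
    _ ≤ 1 * evolve K f t x ^ (1 / k) := by gcongr; exact hsmall t ht
    _ = _ := one_mul _

/-- A supersolution of the Duhamel equation dominates the monotone iteration. -/
lemma exists_fixedPoint_le (hK : IsTransitionDensity K)
    {p : ℝ} (hp : 0 < p) {φ : X → ℝ≥0∞} (hφ : Measurable φ)
    {w : X → ℝ → ℝ≥0∞} (hw : ∀ x t, 0 < t → duhamel K p φ w x t ≤ w x t) :
    ∃ v : X → ℝ → ℝ≥0∞, Measurable (Function.uncurry v) ∧
      (∀ x t, v x t = duhamel K p φ v x t) ∧ ∀ x t, 0 < t → v x t ≤ w x t := by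
  refine ⟨fun x t => ⨆ n, picard K p φ n x t, ?_, hK.iSup_picard_eq hp hφ, fun x t ht => ?_⟩
  · exact Measurable.iSup fun n => hK.measurable_picard hφ n
  · refine iSup_le fun n => ?_
    induction n generalizing x t with
    | zero => exact zero_le
    | succ n ih => exact (duhamel_mono hp.le φ ih x t).trans (hw x t ht)

end IsTransitionDensity

end Evolution

lemma setLIntegral_Ioo_rpow {a t : ℝ} (ha : -1 < a) (ht : 0 < t) :
    ∫⁻ s in Ioo 0 t, ENNReal.ofReal (s ^ a) = ENNReal.ofReal (t ^ (a + 1) / (a + 1)) := by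
  have hi : IntegrableOn (fun s : ℝ => s ^ a) (Ioo 0 t) :=
    ((intervalIntegrable_iff_integrableOn_Ioo_of_le ht.le).1
      (intervalIntegral.intervalIntegrable_rpow' ha))
  rw [← ofReal_integral_eq_lintegral_ofReal hi, ← integral_Ioc_eq_integral_Ioo,
    ← intervalIntegral.integral_of_le ht.le, integral_rpow (Or.inl ha),
    zero_rpow (by linarith), sub_zero]
  exact (ae_restrict_mem measurableSet_Ioo).mono fun s hs => rpow_nonneg hs.1.le a

lemma setLIntegral_Ioi_rpow {a t : ℝ} (ha : a < -1) (ht : 0 < t) :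
    ∫⁻ s in Ioi t, ENNReal.ofReal (s ^ a) = ENNReal.ofReal (-t ^ (a + 1) / (a + 1)) := by
  rw [← ofReal_integral_eq_lintegral_ofReal (integrableOn_Ioi_rpow_of_lt ha ht),
    integral_Ioi_rpow_of_lt ha ht]
  exact (ae_restrict_mem measurableSet_Ioi).mono fun s hs => rpow_nonneg (ht.trans hs).le a

/-- The integral over all times of a power of `min A (B s^{-γ})`, split at `s = T` where the two
bounds agree. -/
lemma lintegral_min_rpow_le_of_eq {A T γ a : ℝ} (hA : 0 < A) (hT : 0 < T) (ha : 0 < a)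
    (hm : 1 < γ * a) :
    ∫⁻ s in Ioi 0, ENNReal.ofReal (min A (A * T ^ γ * s ^ (-γ))) ^ a
      ≤ ENNReal.ofReal (γ * a / (γ * a - 1) * (A ^ a * T)) := by
  have h1 : ∫⁻ s in Ioc 0 T, ENNReal.ofReal (min A (A * T ^ γ * s ^ (-γ))) ^ a
      ≤ ENNReal.ofReal (A ^ a * T) := by
    calc _ ≤ ∫⁻ _ in Ioc 0 T, ENNReal.ofReal (A ^ a) := by
          refine lintegral_mono fun s => ?_
          rw [← ENNReal.ofReal_rpow_of_nonneg hA.le ha.le]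
          exact ENNReal.rpow_le_rpow (ENNReal.ofReal_le_ofReal (min_le_left _ _)) ha.le
      _ = _ := by
          rw [setLIntegral_const, Real.volume_Ioc, sub_zero,
            ← ENNReal.ofReal_mul (rpow_nonneg hA.le a)]
  have h2 : ∫⁻ s in Ioi T, ENNReal.ofReal (min A (A * T ^ γ * s ^ (-γ))) ^ a
      ≤ ENNReal.ofReal (A ^ a * T / (γ * a - 1)) := by
    calc _ ≤ ∫⁻ s in Ioi T, ENNReal.ofReal (A ^ a * T ^ (γ * a)) * ENNReal.ofReal (s ^ (-(γ * a)))
          := by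
          refine setLIntegral_mono' measurableSet_Ioi fun s hs => ?_
          have hs0 : 0 < s := hT.trans hs
          rw [← ENNReal.ofReal_mul (by positivity), rpow_mul hT.le, ← mul_rpow hA.le (by positivity),
            ← neg_mul, rpow_mul hs0.le, ← mul_rpow (by positivity) (by positivity),
            ← ENNReal.ofReal_rpow_of_nonneg (by positivity) ha.le]
          exact ENNReal.rpow_le_rpow (ENNReal.ofReal_le_ofReal (min_le_right _ _)) ha.le
      _ = _ := by
          rw [lintegral_const_mul' _ _ ENNReal.ofReal_ne_top,
            setLIntegral_Ioi_rpow (by linarith) hT, ← ENNReal.ofReal_mul (by positivity)]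
          congr 1
          have h3 : T ^ (γ * a) * T ^ (-(γ * a) + 1) = T := by
            rw [← rpow_add hT, add_neg_cancel_left, rpow_one]
          have h4 : -(γ * a) + 1 ≠ 0 := by linarith
          have h5 : γ * a - 1 ≠ 0 := by linarith
          calc A ^ a * T ^ (γ * a) * (-T ^ (-(γ * a) + 1) / (-(γ * a) + 1))
              = A ^ a * (T ^ (γ * a) * T ^ (-(γ * a) + 1)) * (-1 / (-(γ * a) + 1)) := by ring
            _ = A ^ a * T / (γ * a - 1) := by
                rw [h3]; field_simp; ring
  have h5 : 0 < γ * a - 1 := by linarith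
  calc _ ≤ _ := by
        rw [← Ioc_union_Ioi_eq_Ioi hT.le]
        exact lintegral_union_le _ _ _
    _ ≤ _ := add_le_add h1 h2
    _ = _ := by
        rw [← ENNReal.ofReal_add (by positivity) (by positivity)]
        congr 1
        field_simp
        ring

lemma lintegral_min_rpow_le {A B θ a : ℝ} (hA : 0 ≤ A) (hB : 0 ≤ B) (ha : 0 < a) (hθ : 0 < θ)
    (hθ1 : θ < 1) :
    ∫⁻ s in Ioi 0, ENNReal.ofReal (min A (B * s ^ (-(1 / (θ * a))))) ^ a
      ≤ ENNReal.ofReal (1 / (1 - θ) * (B ^ θ * A ^ (1 - θ)) ^ a) := by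
  rcases hA.eq_or_lt with rfl | hA
  · simp [ha]
  rcases hB.eq_or_lt with rfl | hB
  · simp [min_eq_right hA.le, ha]
  set γ := 1 / (θ * a) with hγ
  have hγ0 : 0 < γ := by positivity
  have hγa : γ * a = 1 / θ := by rw [hγ]; field_simp
  set T := (B / A) ^ (1 / γ)
  have hT : 0 < T := by positivity
  have hBT : B = A * T ^ γ := by
    rw [← rpow_mul (by positivity), one_div, inv_mul_cancel₀ hγ0.ne', rpow_one]
    field_simp
  have hm : 1 < γ * a := by rw [hγa]; exact (one_lt_div hθ).2 hθ1
  have key : (B ^ θ * A ^ (1 - θ)) ^ a = A ^ a * T := by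
    have : B ^ θ * A ^ (1 - θ) = A * T ^ (γ * θ) := by
      rw [hBT, mul_rpow hA.le (by positivity), ← rpow_mul hT.le, mul_right_comm, ← rpow_add hA]
      simp
    rw [this, mul_rpow hA.le (by positivity), ← rpow_mul hT.le,
      show γ * θ * a = 1 by rw [hγ]; field_simp, rpow_one]
  rw [key, hBT]
  refine (lintegral_min_rpow_le_of_eq hA hT ha hm).trans_eq ?_
  rw [hγa]
  congr 2
  have : 1 - θ ≠ 0 := by linarith
  field_simp

/-- The scale-invariant estimate used when the time integral of the sup bound diverges. -/
lemma lintegral_mul_min_rpow_le {A B p k t : ℝ} (hB : 0 ≤ B) (hk : 1 < k) (hkp : k ≤ p)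
    (ht : 0 < t) :
    (∫⁻ s in Ioo 0 t, ENNReal.ofReal (min A (B * s ^ (-(1 / (p - 1))))) ^ (p - k))
        * ENNReal.ofReal (min A (B * t ^ (-(1 / (p - 1))))) ^ (k - 1)
      ≤ ENNReal.ofReal ((p - 1) / (k - 1) * B ^ (p - 1)) := by
  have hp : 0 < p - 1 := by linarith
  have hk1 : 0 < k - 1 := by linarith
  have hle : ∀ s : ℝ, 0 < s → ∀ c : ℝ, 0 ≤ c →
      ENNReal.ofReal (min A (B * s ^ (-(1 / (p - 1))))) ^ c
        ≤ ENNReal.ofReal (B ^ c) * ENNReal.ofReal (s ^ (-(c / (p - 1)))) := fun s hs c hc => by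
    rw [← ENNReal.ofReal_mul (by positivity),
      show -(c / (p - 1)) = -(1 / (p - 1)) * c by ring, rpow_mul hs.le,
      ← mul_rpow hB (by positivity), ← ENNReal.ofReal_rpow_of_nonneg (by positivity) hc]
    exact ENNReal.rpow_le_rpow (ENNReal.ofReal_le_ofReal (min_le_right _ _)) hc
  have ha : -((p - k) / (p - 1)) + 1 = (k - 1) / (p - 1) := by field_simp; ring
  calc _ ≤ (∫⁻ s in Ioo 0 t, ENNReal.ofReal (B ^ (p - k))
            * ENNReal.ofReal (s ^ (-((p - k) / (p - 1)))))
          * (ENNReal.ofReal (B ^ (k - 1)) * ENNReal.ofReal (t ^ (-((k - 1) / (p - 1))))) := by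
        refine mul_le_mul' ?_ (hle t ht _ hk1.le)
        exact setLIntegral_mono' measurableSet_Ioo fun s hs => hle s hs.1 _ (by linarith)
    _ = _ := by
        rw [lintegral_const_mul' _ _ ENNReal.ofReal_ne_top, setLIntegral_Ioo_rpow _ ht, ha,
          ← ENNReal.ofReal_mul (by positivity), ← ENNReal.ofReal_mul (by positivity),
          ← ENNReal.ofReal_mul (by positivity)]
        · congr 1
          have h1 : B ^ (p - k) * B ^ (k - 1) = B ^ (p - 1) := by
            rw [← rpow_add_of_nonneg hB (by linarith) hk1.le]
            ring_nf
          have h2 : t ^ ((k - 1) / (p - 1)) * t ^ (-((k - 1) / (p - 1))) = 1 := by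
            rw [← rpow_add ht, add_neg_cancel, rpow_zero]
          calc _ = (B ^ (p - k) * B ^ (k - 1))
                * (t ^ ((k - 1) / (p - 1)) * t ^ (-((k - 1) / (p - 1)))) / ((k - 1) / (p - 1)) := by
                ring
            _ = _ := by rw [h1, h2]; field_simp
        · have : 0 < (k - 1) / (p - 1) := by positivity
          linarith

/-- A choice of the exponent `k` and of a smallness threshold for which
`duhamel_supersolution_le` applies with the bound `min A (B s^{-γ})`. -/
lemma exists_exponent_threshold {p θ r : ℝ} (hp : 1 < p) (hr : 1 ≤ r) (hθ : 0 < θ) (hθ1 : θ ≤ 1)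
    (hrθ : θ = 1 → 1 < r) :
    ∃ k δ : ℝ, 1 ≤ k ∧ k ≤ p ∧ k ≤ r ∧ 0 < δ ∧ ∀ A B : ℝ, 0 ≤ A → 0 ≤ B →
      B ^ θ * A ^ (1 - θ) ≤ δ → ∀ t : ℝ, 0 < t →
        2 ^ p * (∫⁻ s in Ioo 0 t,
            (ENNReal.ofReal (min A (B * s ^ (-(1 / (θ * (p - 1)))))) ^ k) ^ ((p - k) / k))
          * (ENNReal.ofReal (min A (B * t ^ (-(1 / (θ * (p - 1)))))) ^ k) ^ ((k - 1) / k) ≤ 1 := by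
  have hp1 : 0 < p - 1 := by linarith
  obtain ⟨k, hk1, hkp, hkr, c, hc, hbound⟩ : ∃ k : ℝ, 1 ≤ k ∧ k ≤ p ∧ k ≤ r ∧ ∃ c : ℝ, 0 < c ∧
      ∀ A B : ℝ, 0 ≤ A → 0 ≤ B → ∀ t : ℝ, 0 < t →
        (∫⁻ s in Ioo 0 t, ENNReal.ofReal (min A (B * s ^ (-(1 / (θ * (p - 1)))))) ^ (p - k))
          * ENNReal.ofReal (min A (B * t ^ (-(1 / (θ * (p - 1)))))) ^ (k - 1)
        ≤ ENNReal.ofReal (c * (B ^ θ * A ^ (1 - θ)) ^ (p - 1)) := by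
    rcases hθ1.eq_or_lt with rfl | hθ1
    · refine ⟨min p r, le_min hp.le hr, min_le_left _ _, min_le_right _ _,
        (p - 1) / (min p r - 1), ?_, fun A B hA hB t ht => ?_⟩
      · have := lt_min hp (hrθ rfl)
        exact div_pos hp1 (by linarith)
      · simpa using lintegral_mul_min_rpow_le (A := A) hB (lt_min hp (hrθ rfl)) (min_le_left p r) ht
    · refine ⟨1, le_rfl, hp.le, hr, 1 / (1 - θ), one_div_pos.2 (by linarith),
        fun A B hA hB t ht => ?_⟩
      rw [sub_self, ENNReal.rpow_zero, mul_one]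
      exact (lintegral_mono_set Ioo_subset_Ioi_self).trans
        (lintegral_min_rpow_le hA hB hp1 hθ hθ1)
  have hk0 : 0 < k := by linarith
  refine ⟨k, (2 ^ p * c) ^ (-(1 / (p - 1))), hk1, hkp, hkr, by positivity,
    fun A B hA hB hAB t ht => ?_⟩
  simp_rw [← ENNReal.rpow_mul, mul_div_cancel₀ _ hk0.ne']
  rw [mul_assoc]
  calc _ ≤ (2 : ℝ≥0∞) ^ p * ENNReal.ofReal (c * (B ^ θ * A ^ (1 - θ)) ^ (p - 1)) := by
        gcongr
        exact hbound A B hA hB t ht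
    _ ≤ (2 : ℝ≥0∞) ^ p * ENNReal.ofReal (c * ((2 ^ p * c) ^ (-(1 / (p - 1)))) ^ (p - 1)) := by
        gcongr
    _ = 1 := by
        rw [← rpow_mul (by positivity), show -(1 / (p - 1)) * (p - 1) = -1 by field_simp,
          rpow_neg_one, show (2 : ℝ≥0∞) ^ p = ENNReal.ofReal (2 ^ p) by
            rw [← ENNReal.ofReal_rpow_of_nonneg (by norm_num) (by linarith)]; simp,
          ← ENNReal.ofReal_mul (by positivity), ← ENNReal.ofReal_one]
        congr 1
        field_simp

/-- Existence of a fixed point of the Duhamel operator for small data, together with its sup bound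
and its `L^r` bound, for a transition density of size `t^{-α}`. -/
lemma IsTransitionDensity.exists_fixedPoint {X : Type*} [MeasureSpace X]
    [SFinite (volume : Measure X)] {K : X → X → ℝ → ℝ≥0∞} (hK : IsTransitionDensity K)
    {α p r k C A L : ℝ} (hr : 0 < r) (hk : 1 ≤ k) (hkp : k ≤ p) (hkr : k ≤ r)
    (hC : 0 ≤ C) (hL : 0 ≤ L)
    (hKC : ∀ x y t, 0 < t → K x y t ≤ ENNReal.ofReal (C * t ^ (-α)))
    {φ : X → ℝ≥0∞} (hφ : Measurable φ) (hφA : ∀ᵐ y, φ y ≤ ENNReal.ofReal A)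
    (hφL : ∫⁻ y, φ y ^ r ≤ ENNReal.ofReal L ^ r)
    (hsmall : ∀ t : ℝ, 0 < t →
      2 ^ p * (∫⁻ s in Ioo 0 t,
          (ENNReal.ofReal (min A (C ^ (1 / r) * L * s ^ (-(α / r)))) ^ k) ^ ((p - k) / k))
        * (ENNReal.ofReal (min A (C ^ (1 / r) * L * t ^ (-(α / r)))) ^ k) ^ ((k - 1) / k) ≤ 1) :
    ∃ v : X → ℝ → ℝ≥0∞, Measurable (Function.uncurry v) ∧
      (∀ x t, v x t = duhamel K p φ v x t) ∧
      (∀ x t, 0 < t → v x t ≤ 2 * ENNReal.ofReal (min A (C ^ (1 / r) * L * t ^ (-(α / r))))) ∧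
      ∀ t, 0 < t → ∫⁻ x, v x t ^ r ≤ 2 ^ r * ENNReal.ofReal L ^ r := by
  have hk0 : 0 < k := by linarith
  set g : ℝ → ℝ≥0∞ := fun t => ENNReal.ofReal (min A (C ^ (1 / r) * L * t ^ (-(α / r))))
  have hg : Measurable g := by fun_prop
  have hjen : ∀ x t, 0 < t →
      evolve K (fun y => φ y ^ k) t x ^ (1 / k) ≤ evolve K (fun y => φ y ^ r) t x ^ (1 / r) :=
    fun x t ht => hK.evolve_rpow_le hφ hk0 hkr ht x
  have hsup : ∀ x t, 0 < t → evolve K (fun y => φ y ^ k) t x ^ (1 / k) ≤ g t := fun x t ht => by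
    refine (hjen x t ht).trans ?_
    change _ ≤ ENNReal.ofReal (min _ _)
    rw [ENNReal.ofReal_min, one_div, ENNReal.rpow_inv_le_iff hr]
    rcases min_choice (ENNReal.ofReal A)
      (ENNReal.ofReal (C ^ r⁻¹ * L * t ^ (-(α / r)))) with h | h <;> rw [h]
    · exact hK.evolve_le_of_ae_le (hφA.mono fun y hy => ENNReal.rpow_le_rpow hy hr.le) ht x
    · refine (evolve_le_mul_lintegral (hφ.pow_const r) fun y => hKC x y t ht).trans ?_
      rw [ENNReal.ofReal_rpow_of_nonneg (by positivity) hr.le, mul_rpow (by positivity)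
        (by positivity), mul_rpow (by positivity) hL, ← rpow_mul hC, ← rpow_mul ht.le,
        inv_mul_cancel₀ hr.ne', rpow_one, show -(α / r) * r = -α by field_simp, mul_right_comm,
        ENNReal.ofReal_mul (p := C * t ^ (-α)) (by positivity),
        ← ENNReal.ofReal_rpow_of_nonneg hL hr.le]
      gcongr
  obtain ⟨v, hvm, hvfix, hvle⟩ := hK.exists_fixedPoint_le (by linarith) hφ fun x t ht =>
    hK.duhamel_supersolution_le hk hkp hφ (G := fun t => g t ^ k) (hg.pow_const k)
      (fun x t ht => by
        have := hsup x t ht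
        rwa [one_div, ENNReal.rpow_inv_le_iff hk0] at this) hsmall x ht
  refine ⟨v, hvm, hvfix, fun x t ht => (hvle x t ht).trans ?_, fun t ht => ?_⟩
  · gcongr
    exact hsup x t ht
  · calc ∫⁻ x, v x t ^ r ≤ ∫⁻ x, 2 ^ r * evolve K (fun y => φ y ^ r) t x := by
          refine lintegral_mono fun x => ?_
          have h := (hvle x t ht).trans (mul_le_mul_right (hjen x t ht) 2)
          refine (ENNReal.rpow_le_rpow h hr.le).trans_eq ?_
          rw [ENNReal.mul_rpow_of_nonneg _ _ hr.le, ← ENNReal.rpow_mul, one_div,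
            inv_mul_cancel₀ hr.ne', ENNReal.rpow_one]
      _ = 2 ^ r * ∫⁻ y, φ y ^ r := by
          rw [lintegral_const_mul' _ _ (ENNReal.rpow_ne_top_of_nonneg hr.le (by simp)),
            hK.lintegral_evolve (hφ.pow_const r) ht]
      _ ≤ _ := by gcongr

/-- Interpolation of the `L^q` norm between an `L^r` bound and a uniform bound. -/
lemma eLpNorm_le_of_lintegral_rpow_le_of_enorm_le {X : Type*} [MeasureSpace X] {u : X → ℝ} {r : ℝ}
    (hr : 0 < r) {M D : ℝ≥0∞} (hM : ∀ x, ‖u x‖ₑ ≤ M) (hD : ∫⁻ x, ‖u x‖ₑ ^ r ≤ D)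
    (hMtop : M ≠ ⊤) {q : ℝ≥0∞} (hq : ENNReal.ofReal r ≤ q) :
    eLpNorm u q volume ≤ M ^ (1 - r * q⁻¹.toReal) * D ^ q⁻¹.toReal := by
  rcases eq_or_ne q ⊤ with rfl | hqt
  · simpa using eLpNormEssSup_le_of_ae_enorm_bound (Filter.Eventually.of_forall hM)
  have hrq : r ≤ q.toReal := (ENNReal.ofReal_le_iff_le_toReal hqt).1 hq
  have hq0 : 0 < q.toReal := hr.trans_le hrq
  have hqr : 0 ≤ q.toReal - r := by linarith
  rw [eLpNorm_eq_lintegral_rpow_enorm_toReal (fun h => by simp [h] at hq0) hqt, ENNReal.toReal_inv,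
    one_div]
  calc (∫⁻ x, ‖u x‖ₑ ^ q.toReal) ^ q.toReal⁻¹
      ≤ (M ^ (q.toReal - r) * D) ^ q.toReal⁻¹ := by
        refine ENNReal.rpow_le_rpow ?_ (inv_nonneg.2 hq0.le)
        calc ∫⁻ x, ‖u x‖ₑ ^ q.toReal ≤ ∫⁻ x, M ^ (q.toReal - r) * ‖u x‖ₑ ^ r := by
              refine lintegral_mono fun x => ?_
              rw [← sub_add_cancel q.toReal r, ENNReal.rpow_add_of_nonneg _ _ hqr hr.le,
                sub_add_cancel]
              gcongr ?_ * _
              exact ENNReal.rpow_le_rpow (hM x) hqr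
          _ ≤ _ := by
              rw [lintegral_const_mul' _ _ (ENNReal.rpow_ne_top_of_nonneg hqr hMtop)]
              gcongr
    _ = _ := by
        rw [ENNReal.mul_rpow_of_nonneg _ _ (inv_nonneg.2 hq0.le), ← ENNReal.rpow_mul, sub_mul,
          mul_inv_cancel₀ hq0.ne']

lemma min_mul_rpow_neg_le {A B γ t : ℝ} (hA : 0 ≤ A) (hγ : 0 ≤ γ) (ht : 0 < t) :
    min A (B * t ^ (-γ)) ≤ 2 ^ γ * max A B * (1 + t) ^ (-γ) := by
  rcases le_total t 1 with h | h
  · have : 1 ≤ 2 ^ γ * (1 + t) ^ (-γ) := by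
      rw [rpow_neg (by positivity), ← div_eq_mul_inv, one_le_div (by positivity)]
      exact rpow_le_rpow (by positivity) (by linarith) hγ
    calc min A (B * t ^ (-γ)) ≤ max A B := (min_le_left _ _).trans (le_max_left _ _)
      _ ≤ max A B * (2 ^ γ * (1 + t) ^ (-γ)) := le_mul_of_one_le_right (le_max_of_le_left hA) this
      _ = _ := by ring
  · have : t ^ (-γ) ≤ 2 ^ γ * (1 + t) ^ (-γ) := by
      rw [rpow_neg (by positivity), rpow_neg (by positivity), ← div_eq_mul_inv,
        inv_eq_one_div, div_le_div_iff₀ (by positivity) (by positivity), one_mul,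
        ← mul_rpow (by norm_num) ht.le]
      exact rpow_le_rpow (by positivity) (by linarith) hγ
    calc min A (B * t ^ (-γ)) ≤ max A B * t ^ (-γ) :=
          (min_le_right _ _).trans (by gcongr; exact le_max_right _ _)
      _ ≤ max A B * (2 ^ γ * (1 + t) ^ (-γ)) := by gcongr
      _ = _ := by ring

lemma lintegral_ofReal_eq_one {X : Type*} [MeasureSpace X] {f : X → ℝ} (hf : ∀ x, 0 ≤ f x)
    (h : ∫ x, f x = 1) : ∫⁻ x, ENNReal.ofReal (f x) = 1 := by
  have hi : Integrable f := by
    by_contra hn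
    simp [integral_undef hn] at h
  rw [← ofReal_integral_eq_lintegral_ofReal hi (Filter.Eventually.of_forall hf), h,
    ENNReal.ofReal_one]

lemma isTransitionDensity_ofReal {X : Type*} [MeasureSpace X] {Γ : X → X → ℝ → ℝ} {c : ℝ → ℝ}
    (hmeas : Measurable fun q : X × X × ℝ => Γ q.1 q.2.1 q.2.2)
    (hnonneg : ∀ x y : X, ∀ t : ℝ, 0 < t → 0 ≤ Γ x y t)
    (hleft : ∀ y : X, ∀ t : ℝ, 0 < t → ∫ x : X, Γ x y t = 1)
    (hright : ∀ x : X, ∀ t : ℝ, 0 < t → ∫ y : X, Γ x y t = 1)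
    (hsemi : ∀ x y : X, ∀ s t : ℝ, 0 < s → s < t →
      Γ x y t = ∫ ξ : X, Γ x ξ (t - s) * Γ ξ y s)
    (hbound : ∀ x y : X, ∀ t : ℝ, 0 < t → Γ x y t ≤ c t) :
    IsTransitionDensity fun x y t => ENNReal.ofReal (Γ x y t) where
  measurable := hmeas.ennreal_ofReal
  lintegral_left y t ht := lintegral_ofReal_eq_one (fun x => hnonneg x y t ht) (hleft y t ht)
  lintegral_right x t ht := lintegral_ofReal_eq_one (fun y => hnonneg x y t ht) (hright x t ht)
  semigroup x y s t hs hst := by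
    have hts : 0 < t - s := sub_pos.2 hst
    have hi : Integrable fun ξ => Γ x ξ (t - s) := by
      by_contra hn
      simpa [integral_undef hn] using hright x (t - s) hts
    have hm : Measurable fun ξ => Γ ξ y s := hmeas.comp (f := fun ξ : X => (ξ, y, s)) (by fun_prop)
    have hi2 : Integrable fun ξ => Γ x ξ (t - s) * Γ ξ y s := by
      refine hi.mul_bdd (c := c s) hm.aestronglyMeasurable
        (Filter.Eventually.of_forall fun ξ => ?_)
      rw [Real.norm_of_nonneg (hnonneg ξ y s hs)]
      exact hbound ξ y s hs
    rw [hsemi x y s t hs hst, ofReal_integral_eq_lintegral_ofReal hi2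
      (Filter.Eventually.of_forall fun ξ => mul_nonneg (hnonneg _ _ _ hts) (hnonneg _ _ _ hs))]
    exact lintegral_congr fun ξ => ENNReal.ofReal_mul (hnonneg _ _ _ hts)

/-- A bounded fixed point of the Duhamel operator is a global mild solution. -/
lemma isMildSolution_toReal {N : ℕ} {p : ℝ} (hp : 0 ≤ p) {Γ : E N → E N → ℝ → ℝ}
    (hmeas : Measurable fun q : E N × E N × ℝ => Γ q.1 q.2.1 q.2.2)
    (hnonneg : ∀ x y : E N, ∀ t : ℝ, 0 < t → 0 ≤ Γ x y t)
    {φ : E N → ℝ} (hφ : Measurable φ) (hφ0 : ∀ x, 0 ≤ φ x) {v : E N → ℝ → ℝ≥0∞}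
    (hv : Measurable (Function.uncurry v))
    (hfix : ∀ x t, v x t = duhamel (fun x y t => ENNReal.ofReal (Γ x y t)) p
      (fun y => ENNReal.ofReal (φ y)) v x t)
    {M : ℝ≥0∞} (hM : M ≠ ⊤) (hvM : ∀ x t, 0 < t → v x t ≤ M) :
    IsMildSolution N p Γ φ ⊤ fun x t => (v x t).toReal := by
  have hvtop : ∀ x t, 0 < t → v x t ≠ ⊤ := fun x t ht => ne_top_of_le_ne_top hM (hvM x t ht)
  have hu : Measurable fun q : E N × ℝ => (v q.1 q.2).toReal := hv.ennreal_toReal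
  refine ⟨hu, fun x t => ENNReal.toReal_nonneg, ⟨M.toReal, fun t ht _ =>
    Filter.Eventually.of_forall fun x => ENNReal.toReal_mono hM (hvM x t ht)⟩,
    fun t ht _ => Filter.Eventually.of_forall fun x => ?_⟩
  have hvx := hfix x t
  have htop := hvtop x t ht
  rw [hvx] at htop
  unfold duhamel at htop hvx
  obtain ⟨htop1, htop2⟩ := ENNReal.add_ne_top.1 htop
  have hm1 : Measurable fun y => Γ x y t * φ y :=
    (hmeas.comp (f := fun y : E N => (x, y, t)) (by fun_prop)).mul hφ
  have hm2 : Measurable fun q : E N × ℝ => Γ x q.1 (t - q.2) * (v q.1 q.2).toReal ^ p :=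
    (hmeas.comp (f := fun q : E N × ℝ => (x, q.1, t - q.2)) (by fun_prop)).mul (hu.pow_const p)
  have hpos1 : ∀ y, 0 ≤ Γ x y t * φ y := fun y => mul_nonneg (hnonneg x y t ht) (hφ0 y)
  have hpos2 : 0 ≤ᵐ[volume.prod (volume.restrict (Ioo (0 : ℝ) t))]
      fun q : E N × ℝ => Γ x q.1 (t - q.2) * (v q.1 q.2).toReal ^ p := by
    rw [← Measure.restrict_univ (μ := (volume : Measure (E N))), Measure.prod_restrict]
    filter_upwards [ae_restrict_mem (MeasurableSet.univ.prod measurableSet_Ioo)] with q hq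
    exact mul_nonneg (hnonneg _ _ _ (sub_pos.2 hq.2.2)) (by positivity)
  have hl1 : ∫⁻ y, ENNReal.ofReal (Γ x y t * φ y)
      = evolve (fun x y t => ENNReal.ofReal (Γ x y t)) (fun y => ENNReal.ofReal (φ y)) t x :=
    lintegral_congr fun y => ENNReal.ofReal_mul (hnonneg x y t ht)
  have hl2 : ∫⁻ q, ENNReal.ofReal (Γ x q.1 (t - q.2) * (v q.1 q.2).toReal ^ p)
        ∂volume.prod (volume.restrict (Ioo (0 : ℝ) t))
      = ∫⁻ s in Ioo 0 t, evolve (fun x y t => ENNReal.ofReal (Γ x y t))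
          (fun y => v y s ^ p) (t - s) x := by
    rw [lintegral_prod_symm' _ hm2.ennreal_ofReal]
    refine setLIntegral_congr_fun measurableSet_Ioo fun s hs => lintegral_congr fun y => ?_
    dsimp only
    rw [ENNReal.ofReal_mul (hnonneg _ _ _ (sub_pos.2 hs.2)),
      ← ENNReal.ofReal_rpow_of_nonneg ENNReal.toReal_nonneg hp,
      ENNReal.ofReal_toReal (hvtop y s hs.1)]
  have hi1 : Integrable fun y => Γ x y t * φ y :=
    lintegral_ofReal_ne_top_iff_integrable hm1.aestronglyMeasurable
      (Filter.Eventually.of_forall hpos1) |>.1 (by rwa [hl1])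
  have hi2 : Integrable (fun q : E N × ℝ => Γ x q.1 (t - q.2) * (v q.1 q.2).toReal ^ p)
      (volume.prod (volume.restrict (Ioo (0 : ℝ) t))) :=
    lintegral_ofReal_ne_top_iff_integrable hm2.aestronglyMeasurable hpos2 |>.1 (by rwa [hl2])
  refine ⟨hi1, hi2, ?_⟩
  beta_reduce
  rw [hvx, ENNReal.toReal_add htop1 htop2, ← integral_prod_symm _ hi2,
    integral_eq_lintegral_of_nonneg_ae (Filter.Eventually.of_forall hpos1)
      hm1.aestronglyMeasurable, hl1,
    integral_eq_lintegral_of_nonneg_ae hpos2 hm2.aestronglyMeasurable, hl2]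

/-- Theorem 1.4(ii): global existence for data small in the interpolated
`L^r`–`L^∞` sense, for any nonnegative kernel satisfying (K1), (K2) and the
upper Gaussian-type bound, with the decay estimate in `L^q` for `r ≤ q ≤ ∞`. -/
theorem global_existence_Lp_radial_weight
    (N : ℕ) (hN : 1 ≤ N) (b : ℝ) (hb1 : -(N : ℝ) < b) (hb2 : b < 1)
    (p : ℝ) (hp : 1 + (2 - b) / N < p)
    (rs : ℝ) (hrs : rs = N * (p - 1) / (2 - b))
    (r : ℝ) (hr1 : 1 ≤ r) (hr2 : r ≤ rs)
    (Γ : E N → E N → ℝ → ℝ)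
    (hΓmeas : Measurable (fun q : E N × E N × ℝ => Γ q.1 q.2.1 q.2.2))
    (hΓnonneg : ∀ x y : E N, ∀ t : ℝ, 0 < t → 0 ≤ Γ x y t)
    (hK1x : ∀ y : E N, ∀ t : ℝ, 0 < t → ∫ x : E N, Γ x y t = 1)
    (hK1y : ∀ x : E N, ∀ t : ℝ, 0 < t → ∫ y : E N, Γ x y t = 1)
    (hK2 : ∀ x y : E N, ∀ s t : ℝ, 0 < s → s < t →
      Γ x y t = ∫ ξ : E N, Γ x ξ (t - s) * Γ ξ y s)
    (hupp : ∃ C₀ c₀ : ℝ, 0 < C₀ ∧ 0 < c₀ ∧ ∀ x y : E N, ∀ t : ℝ, 0 < t →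
      Γ x y t ≤ C₀ * t ^ (-(N : ℝ) / (2 - b)) *
        Real.exp (-c₀ * (‖x - y‖ ^ (2 - b) / t) ^ (1 / (1 - b)))) :
    ∃ δ : ℝ, 0 < δ ∧ ∀ φ : E N → ℝ, Measurable φ → (∀ x, 0 ≤ φ x) →
      eLpNorm φ ⊤ volume ≠ ⊤ → eLpNorm φ (ENNReal.ofReal r) volume ≠ ⊤ →
      (eLpNorm φ (ENNReal.ofReal r) volume) ^ (r / rs) *
        (eLpNorm φ ⊤ volume) ^ (1 - r / rs) < ENNReal.ofReal δ →
      ∃ u : E N → ℝ → ℝ, IsMildSolution N p Γ φ ⊤ u ∧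
        ∀ q : ℝ≥0∞, ENNReal.ofReal r ≤ q → ∃ C : ℝ≥0∞, C ≠ ⊤ ∧ ∀ t : ℝ, 0 < t →
          ENNReal.ofReal ((1 + t) ^ ((N : ℝ) / (2 - b) * (1 / r - q⁻¹.toReal))) *
            eLpNorm (fun x => u x t) q volume ≤ C := by
  obtain ⟨C, c, hC, hc, hΓC⟩ := hupp
  set α : ℝ := N / (2 - b) with hα
  have hN0 : (0 : ℝ) < N := by exact_mod_cast hN
  have hb : 0 < 2 - b := by linarith
  have hα0 : 0 < α := by positivity
  have hp1 : 0 < p - 1 := by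
    have : 0 < (2 - b) / N := by positivity
    linarith
  have hrsα : rs = α * (p - 1) := by rw [hrs, hα]; ring
  have hrs1 : 1 < rs := by
    rw [hrs, one_lt_div hb, ← div_lt_iff₀' hN0]
    linarith
  have hr0 : 0 < r := by linarith
  have hrs0 : 0 < rs := by linarith
  have hbound : ∀ x y : E N, ∀ t : ℝ, 0 < t → Γ x y t ≤ C * t ^ (-α) := fun x y t ht => by
    refine (hΓC x y t ht).trans ?_
    rw [neg_div]
    refine mul_le_of_le_one_right (by positivity) (exp_le_one_iff.2 ?_)
    rw [neg_mul, neg_nonpos]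
    positivity
  have hK := isTransitionDensity_ofReal hΓmeas hΓnonneg hK1x hK1y hK2 hbound
  obtain ⟨k, δ, hk1, hkp, hkr, hδ, hthr⟩ := exists_exponent_threshold (p := p) (θ := r / rs)
    (r := r) (by linarith) hr1 (by positivity) ((div_le_one hrs0).2 hr2)
    (fun h => by rw [div_eq_one_iff_eq hrs0.ne'] at h; linarith)
  have hγ : 1 / (r / rs * (p - 1)) = α / r := by rw [hrsα]; field_simp
  rw [hγ] at hthr
  refine ⟨δ / C ^ (1 / rs), by positivity, fun φ hφ hφ0 hφtop hφr hφδ => ?_⟩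
  set A := (eLpNorm φ ⊤ volume).toReal with hA
  set L := (eLpNorm φ (ENNReal.ofReal r) volume).toReal with hL
  have hA0 : 0 ≤ A := ENNReal.toReal_nonneg
  have hL0 : 0 ≤ L := ENNReal.toReal_nonneg
  have hφA : ∀ᵐ y, ENNReal.ofReal (φ y) ≤ ENNReal.ofReal A := by
    rw [hA, ENNReal.ofReal_toReal hφtop, eLpNorm_exponent_top]
    filter_upwards [ae_le_eLpNormEssSup (f := φ) (μ := volume)] with y hy
    rwa [Real.enorm_of_nonneg (hφ0 y)] at hy
  have hφL : ∫⁻ y, ENNReal.ofReal (φ y) ^ r ≤ ENNReal.ofReal L ^ r := by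
    rw [hL, ENNReal.ofReal_toReal hφr, eLpNorm_eq_lintegral_rpow_enorm_toReal (by simpa using hr0)
      ENNReal.ofReal_ne_top, ENNReal.toReal_ofReal hr0.le, ← ENNReal.rpow_mul, one_div,
      inv_mul_cancel₀ hr0.ne', ENNReal.rpow_one]
    exact lintegral_mono fun y => by rw [Real.enorm_of_nonneg (hφ0 y)]
  have hθ1 : 0 ≤ 1 - r / rs := sub_nonneg.2 ((div_le_one hrs0).2 hr2)
  have hsmall : (C ^ (1 / r) * L) ^ (r / rs) * A ^ (1 - r / rs) ≤ δ := by
    rw [← ENNReal.ofReal_toReal hφtop, ← ENNReal.ofReal_toReal hφr,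
      ENNReal.ofReal_rpow_of_nonneg hL0 (by positivity), ENNReal.ofReal_rpow_of_nonneg hA0 hθ1,
      ← ENNReal.ofReal_mul (by positivity)] at hφδ
    have h := ((ENNReal.ofReal_lt_ofReal_iff_of_nonneg (by positivity)).1 hφδ).le
    rw [le_div_iff₀ (by positivity)] at h
    rw [mul_rpow (by positivity) hL0, ← rpow_mul hC.le,
      show 1 / r * (r / rs) = 1 / rs by field_simp]
    linarith
  obtain ⟨v, hvm, hvfix, hvsup, hvr⟩ := hK.exists_fixedPoint (α := α) (A := A) (L := L) hr0 hk1 hkp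
    hkr hC.le hL0 (fun x y t ht => ENNReal.ofReal_le_ofReal (hbound x y t ht)) hφ.ennreal_ofReal
    hφA hφL (hthr A _ hA0 (by positivity) hsmall)
  set m : ℝ := 2 * (2 ^ (α / r) * max A (C ^ (1 / r) * L))
  have hm0 : 0 ≤ m := by have := hA0.trans (le_max_left A (C ^ (1 / r) * L)); positivity
  have hvdecay : ∀ x t, 0 < t → v x t ≤ ENNReal.ofReal (m * (1 + t) ^ (-(α / r))) :=
    fun x t ht => by
      refine (hvsup x t ht).trans ?_
      rw [← ENNReal.ofReal_ofNat 2, ← ENNReal.ofReal_mul (by norm_num)]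
      change _ ≤ ENNReal.ofReal (2 * _ * _)
      rw [mul_assoc 2]
      exact ENNReal.ofReal_le_ofReal (mul_le_mul_of_nonneg_left
        (min_mul_rpow_neg_le hA0 (div_nonneg hα0.le hr0.le) ht) two_pos.le)
  have hvm_le : ∀ x t, 0 < t → v x t ≤ ENNReal.ofReal m := fun x t ht => by
    refine (hvdecay x t ht).trans (ENNReal.ofReal_le_ofReal ?_)
    refine mul_le_of_le_one_right hm0 (rpow_le_one_of_one_le_of_nonpos (by linarith) ?_)
    rw [neg_nonpos]
    positivity
  refine ⟨fun x t => (v x t).toReal, isMildSolution_toReal (by linarith) hΓmeas hΓnonneg hφ hφ0 hvm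
    hvfix ENNReal.ofReal_ne_top hvm_le, fun q hq => ?_⟩
  have hq0 : r * q⁻¹.toReal ≤ 1 := by
    rcases eq_or_ne q ⊤ with rfl | hqt
    · simp
    have hrq : r ≤ q.toReal := (ENNReal.ofReal_le_iff_le_toReal hqt).1 hq
    rw [ENNReal.toReal_inv, ← div_eq_mul_inv]
    exact (div_le_one (by linarith)).2 hrq
  have hq1 : 0 ≤ 1 - r * q⁻¹.toReal := by linarith
  refine ⟨ENNReal.ofReal m ^ (1 - r * q⁻¹.toReal)
    * (2 ^ r * ENNReal.ofReal L ^ r) ^ q⁻¹.toReal, ?_, fun t ht => ?_⟩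
  · refine ENNReal.mul_ne_top (ENNReal.rpow_ne_top_of_nonneg hq1 ENNReal.ofReal_ne_top)
      (ENNReal.rpow_ne_top_of_nonneg ENNReal.toReal_nonneg (ENNReal.mul_ne_top ?_ ?_))
    · exact ENNReal.rpow_ne_top_of_nonneg hr0.le (by simp)
    · exact ENNReal.rpow_ne_top_of_nonneg hr0.le ENNReal.ofReal_ne_top
  · have henorm : ∀ x, ‖(v x t).toReal‖ₑ = v x t := fun x => by
      rw [Real.enorm_of_nonneg ENNReal.toReal_nonneg, ENNReal.ofReal_toReal
        (ne_top_of_le_ne_top ENNReal.ofReal_ne_top (hvm_le x t ht))]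
    have h := eLpNorm_le_of_lintegral_rpow_le_of_enorm_le (u := fun x => (v x t).toReal) hr0
      (fun x => (henorm x).trans_le (hvdecay x t ht))
      ((lintegral_congr fun x => by rw [henorm]).trans_le (hvr t ht)) ENNReal.ofReal_ne_top hq
    refine (mul_le_mul_right h _).trans_eq ?_
    have h1t : (0 : ℝ) < 1 + t := by linarith
    rw [← mul_assoc, ENNReal.ofReal_rpow_of_nonneg (by positivity) hq1,
      ← ENNReal.ofReal_mul (by positivity), mul_rpow hm0 (by positivity), ← rpow_mul h1t.le,
      mul_left_comm, ← rpow_add h1t, show α * (1 / r - q⁻¹.toReal)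
        + -(α / r) * (1 - r * q⁻¹.toReal) = 0 by field_simp; ring, rpow_zero, mul_one,
      ← ENNReal.ofReal_rpow_of_nonneg hm0 hq1]
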